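/- arXiv:2405.18160 — 3 statements merged into one kernel-verified Lean document; each statement's English description precedes it below -/
import Mathlib

section
/- For u = (z₀, ξ₀) and v = (z_K, ξ_K) in ℝ^ℓ × ℝ^{d−ℓ}, define 𝒬_c(u, v) = (1/2) ∫_{(ℝ^{d−ℓ})^{K−1}} [ min( exp(−βV(z₀, ξ₀)) Q(z₀, z_K) ∏_{k=1}^{K} P_{z̄_k(z₀, z_K)}(ξ_{k−1}, ξ_k), exp(−βV(z_K, ξ_K)) Q(z_K, z₀) ∏_{k=0}^{K−1} P_{z̄_k(z_K, z₀)}(ξ_{K−k}, ξ_{K−k−1}) ) + min( exp(−βV(z₀, ξ₀)) Q(z₀, z_K) ∏_{k=1}^{K} P_{z̄_{k−1}(z₀, z_K)}(ξ_{k−1}, ξ_k), exp(−βV(z_K, ξ_K)) Q(z_K, z₀) ∏_{k=0}^{K−1} P_{z̄_{k+1}(z_K, z₀)}(ξ_{K−k}, ξ_{K−k−1}) ) ] dξ_1 ⋯ dξ_{K−1}, where ξ₀ and ξ_K are the fixed endpoint coordinates. Then 𝒬_c is symmetric: 𝒬_c(u, v) = 𝒬_c(v, u) for all u, v ∈ ℝ^ℓ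 × ℝ^{d−ℓ}. -/
open MeasureTheory

/-- The path `(ξ_0, ξ_1, …, ξ_{K-1}, ξ_K)` with fixed endpoints `ξ_0 = a`,
`ξ_K = b` and interior points `ξ_k = η_{k-1}` for `1 ≤ k ≤ K − 1`. -/
def pathFun {X : Type*} (K : ℕ) (a b : X) (η : Fin (K - 1) → X) : ℕ → X :=
  fun k => if h : 1 ≤ k ∧ k < K then η ⟨k - 1, by omega⟩ else if k = 0 then a else b

lemma pathFun_comp_rev {X : Type*} {K : ℕ} (hK : 1 ≤ K) (a b : X) (η : Fin (K - 1) → X)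
    {k : ℕ} (hk : k ≤ K) :
    pathFun K b a (η ∘ Fin.rev) k = pathFun K a b η (K - k) := by
  unfold pathFun
  by_cases h : 1 ≤ k ∧ k < K
  · have h' : 1 ≤ K - k ∧ K - k < K := by omega
    rw [dif_pos h, dif_pos h', Function.comp_apply]
    congr 1
    ext
    simp only [Fin.val_rev]
    omega
  · have h' : ¬ (1 ≤ K - k ∧ K - k < K) := by omega
    rw [dif_neg h, dif_neg h']
    split_ifs <;> first | rfl | omega

lemma prod_pathFun_comp_rev {X M : Type*} [CommMonoid M] {K : ℕ} (hK : 1 ≤ K) (a b : X)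
    (η : Fin (K - 1) → X) (F : ℕ → X → X → M) :
    ∏ k ∈ Finset.Icc 1 K, F k (pathFun K b a (η ∘ Fin.rev) (k - 1))
        (pathFun K b a (η ∘ Fin.rev) k) =
      ∏ k ∈ Finset.range K, F (k + 1) (pathFun K a b η (K - k))
        (pathFun K a b η (K - k - 1)) := by
  rw [← Finset.Ico_add_one_right_eq_Icc, Finset.range_eq_Ico, ← Finset.prod_Ico_add' _ 0 K 1]
  refine Finset.prod_congr rfl fun k hk => ?_
  rw [Finset.mem_Ico] at hk
  rw [Nat.add_sub_cancel, pathFun_comp_rev hK _ _ _ (by omega),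
    pathFun_comp_rev hK _ _ _ (by omega), Nat.sub_sub]

lemma comp_rev_comp_rev {X : Type*} {n : ℕ} (η : Fin n → X) : (η ∘ Fin.rev) ∘ Fin.rev = η := by
  ext i
  simp

lemma integral_comp_rev {X E : Type*} [MeasureSpace X] [SigmaFinite (volume : Measure X)]
    [NormedAddCommGroup E] [NormedSpace ℝ E] {n : ℕ} (f : (Fin n → X) → E) :
    ∫ η, f (η ∘ Fin.rev) = ∫ η, f η :=
  (volume_preserving_arrowCongr' Fin.revPerm (MeasurableEquiv.refl X)
    (MeasurePreserving.id _)).integral_comp' f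

/-- Symmetry of the accepted-move joint density `𝒬_c` of the stochastically
symmetric ('coin') path algorithm: the two summands correspond to the coin
values `C = 1` and `C = 0`, and `𝒬_c(u, v) = 𝒬_c(v, u)`. -/
theorem stmt5 (ℓ d : ℕ) (hℓ : 0 < ℓ) (hld : ℓ < d)
    (β : ℝ) (hβ : 0 < β)
    (V : (Fin ℓ → ℝ) → (Fin (d - ℓ) → ℝ) → ℝ)
    (hV : Measurable (Function.uncurry V))
    (Q : (Fin ℓ → ℝ) → (Fin ℓ → ℝ) → ℝ)
    (hQmeas : Measurable (Function.uncurry Q))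
    (hQnonneg : ∀ z z', 0 ≤ Q z z')
    (P : (Fin ℓ → ℝ) → (Fin (d - ℓ) → ℝ) → (Fin (d - ℓ) → ℝ) → ℝ)
    (hPmeas : Measurable (fun q : (Fin ℓ → ℝ) × (Fin (d - ℓ) → ℝ) × (Fin (d - ℓ) → ℝ) =>
      P q.1 q.2.1 q.2.2))
    (hPnonneg : ∀ z x y, 0 ≤ P z x y)
    (K : ℕ) (hK : 1 ≤ K)
    (zbar : ℕ → (Fin ℓ → ℝ) → (Fin ℓ → ℝ) → (Fin ℓ → ℝ))
    (hzbarmeas : ∀ k, Measurable (Function.uncurry (zbar k)))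
    (hzbar0 : ∀ a b, zbar 0 a b = a)
    (hzbarK : ∀ a b, zbar K a b = b)
    (Qc : ((Fin ℓ → ℝ) × (Fin (d - ℓ) → ℝ)) →
      ((Fin ℓ → ℝ) × (Fin (d - ℓ) → ℝ)) → ℝ)
    (hQc : ∀ u v, Qc u v = (1 / 2) *
      ∫ η : Fin (K - 1) → (Fin (d - ℓ) → ℝ),
        (min
          (Real.exp (-β * V u.1 u.2) * Q u.1 v.1 *
            ∏ k ∈ Finset.Icc 1 K,
              P (zbar k u.1 v.1) (pathFun K u.2 v.2 η (k - 1)) (pathFun K u.2 v.2 η k))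
          (Real.exp (-β * V v.1 v.2) * Q v.1 u.1 *
            ∏ k ∈ Finset.range K,
              P (zbar k v.1 u.1) (pathFun K u.2 v.2 η (K - k))
                (pathFun K u.2 v.2 η (K - k - 1))) +
        min
          (Real.exp (-β * V u.1 u.2) * Q u.1 v.1 *
            ∏ k ∈ Finset.Icc 1 K,
              P (zbar (k - 1) u.1 v.1) (pathFun K u.2 v.2 η (k - 1)) (pathFun K u.2 v.2 η k))
          (Real.exp (-β * V v.1 v.2) * Q v.1 u.1 *
            ∏ k ∈ Finset.range K,
              P (zbar (k + 1) v.1 u.1) (pathFun K u.2 v.2 η (K - k))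
                (pathFun K u.2 v.2 η (K - k - 1))))) :
    ∀ u v, Qc u v = Qc v u := by
  intro u v
  rw [hQc u v, hQc v u, ← integral_comp_rev]
  congr 2
  funext η
  rw [prod_pathFun_comp_rev hK v.2 u.2 η fun k => P (zbar k u.1 v.1),
    prod_pathFun_comp_rev hK v.2 u.2 η fun k => P (zbar (k - 1) u.1 v.1)]
  have h₁ := prod_pathFun_comp_rev hK u.2 v.2 (η ∘ Fin.rev) fun k => P (zbar k v.1 u.1)
  have h₂ := prod_pathFun_comp_rev hK u.2 v.2 (η ∘ Fin.rev) fun k => P (zbar (k - 1) v.1 u.1)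
  rw [comp_rev_comp_rev] at h₁ h₂
  simp only [Nat.add_sub_cancel] at h₂ ⊢
  rw [h₁, h₂, add_comm]
  congr 1 <;> exact min_comm _ _
end

section
/- Assume in addition that ∫ Q(z, z̃) dz̃ = 1 for all z and ∫ P_z(x, y) dy = 1 for all z, x, and that 𝒵 := ∫_{ℝ^d} exp(−βV(z, x^⊥)) dz dx^⊥ ∈ (0,∞). With 𝒬_c as above, one has ∫ 𝒬_c(u, w) dw ≤ exp(−βV(u)) for all u, and the measure π(du dv) = 𝒵^{−1} 𝒬_c(u, v) du dv + δ_u(dv) (𝒵^{−1} exp(−βV(u)) − 𝒵^{−1} ∫ 𝒬_c(u, w) dw) du on (ℝ^ℓ × ℝ^{d−ℓ})² is invariant under the swap (u, v) ↦ (v, u). Consequently, the Markov chain generated by the stochastically symmetric (coin) path algorithm is reversible with respect to ν(du) = 𝒵^{−1} exp(−βV(u)) du. -/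
open MeasureTheory

theorem measurable_pathFun {X : Type*} [MeasurableSpace X] (n k : ℕ) :
    Measurable fun q : X × X × (Fin n → X) => pathFun (n + 1) q.1 q.2.1 q.2.2 k := by
  unfold pathFun
  split_ifs <;> fun_prop

theorem pathFun_cons_succ {X : Type*} (n : ℕ) (a b x : X) (η : Fin n → X) (k : ℕ) :
    pathFun (n + 2) a b (Fin.cons x η : Fin (n + 1) → X) (k + 1) =
      pathFun (n + 1) x b η k := by
  rcases k with _ | k
  · simp [pathFun]
  · by_cases h : k < n
    · simp only [pathFun]
      rw [dif_pos (by omega), dif_pos (by omega)]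
      exact Fin.cons_succ (α := fun _ => X) x η ⟨k, h⟩
    · simp only [pathFun]
      rw [dif_neg (by omega), dif_neg (by omega)]
      simp

theorem pathFun_rev {X : Type*} (K : ℕ) (hK : 1 ≤ K) (a b : X) (η : Fin (K - 1) → X)
    (k : ℕ) (hk : k ≤ K) :
    pathFun K b a (fun i => η i.rev) k = pathFun K a b η (K - k) := by
  simp only [pathFun]
  by_cases h : 1 ≤ k ∧ k < K
  · rw [dif_pos h, dif_pos (by omega)]
    congr 1
    ext
    simp only [Fin.val_rev]
    omega
  · rw [dif_neg h, dif_neg (by omega)]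
    split_ifs <;> first | rfl | omega

theorem lintegral_prod_pathFun {X : Type*} [MeasureSpace X] [SigmaFinite (volume : Measure X)]
    (n : ℕ) (p : ℕ → X → X → ENNReal) (hp : ∀ k, Measurable (Function.uncurry (p k)))
    (hp1 : ∀ k x, ∫⁻ y, p k x y = 1) (a : X) :
    ∫⁻ b, ∫⁻ η : Fin n → X, ∏ k ∈ Finset.range (n + 1),
      p k (pathFun (n + 1) a b η k) (pathFun (n + 1) a b η (k + 1)) = 1 := by
  induction n generalizing p a with
  | zero =>
    rw [← hp1 0 a]
    refine lintegral_congr fun b => ?_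
    rw [lintegral_unique, volume_pi, Measure.pi_of_empty]
    simp [pathFun]
  | succ n ih =>
    have hm : Measurable fun q : X × X × (Fin n → X) => ∏ k ∈ Finset.range (n + 1),
        p (k + 1) (pathFun (n + 1) q.1 q.2.1 q.2.2 k)
          (pathFun (n + 1) q.1 q.2.1 q.2.2 (k + 1)) :=
      Finset.measurable_prod _ fun k _ =>
        (hp (k + 1)).comp ((measurable_pathFun n k).prodMk (measurable_pathFun n (k + 1)))
    have hp0 : Measurable (p 0 a) := (hp 0).of_uncurry_left
    have key : ∀ b, ∫⁻ η : Fin (n + 1) → X, ∏ k ∈ Finset.range (n + 1 + 1),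
        p k (pathFun (n + 1 + 1) a b η k) (pathFun (n + 1 + 1) a b η (k + 1)) =
        ∫⁻ x, p 0 a x * ∫⁻ η : Fin n → X, ∏ k ∈ Finset.range (n + 1),
          p (k + 1) (pathFun (n + 1) x b η k) (pathFun (n + 1) x b η (k + 1)) := by
      intro b
      have hmb : Measurable fun q : X × (Fin n → X) => p 0 a q.1 * ∏ k ∈ Finset.range (n + 1),
          p (k + 1) (pathFun (n + 1) q.1 b q.2 k) (pathFun (n + 1) q.1 b q.2 (k + 1)) :=
        (hp0.comp measurable_fst).mul
          (hm.comp (measurable_fst.prodMk (measurable_const.prodMk measurable_snd)))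
      rw [← ((volume_preserving_piFinSuccAbove (fun _ : Fin (n + 1) => X) 0).symm).lintegral_comp_emb
        (MeasurableEquiv.measurableEmbedding _), Measure.volume_eq_prod]
      refine (lintegral_congr fun q => ?_).trans ((lintegral_prod _ hmb.aemeasurable).trans
        (lintegral_congr fun x => ?_))
      · have hcons : (MeasurableEquiv.piFinSuccAbove (fun _ : Fin (n + 1) => X) 0).symm q =
            (Fin.cons q.1 q.2 : Fin (n + 1) → X) := by
          ext i
          simp [MeasurableEquiv.piFinSuccAbove, Fin.insertNthEquiv]
        rw [hcons, Finset.prod_range_succ', mul_comm]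
        simp only [pathFun_cons_succ]
        simp [pathFun]
      · dsimp only
        refine lintegral_const_mul _ ?_
        exact hm.comp (f := fun η : Fin n → X => (x, b, η))
           (measurable_const.prodMk (measurable_const.prodMk measurable_id))
    have hm' : Measurable fun q : X × X => p 0 a q.2 *
        ∫⁻ η : Fin n → X, ∏ k ∈ Finset.range (n + 1),
          p (k + 1) (pathFun (n + 1) q.2 q.1 η k) (pathFun (n + 1) q.2 q.1 η (k + 1)) := by
      refine (hp0.comp measurable_snd).mul (Measurable.lintegral_prod_right'
        (f := fun r : (X × X) × (Fin n → X) => ∏ k ∈ Finset.range (n + 1),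
          p (k + 1) (pathFun (n + 1) r.1.2 r.1.1 r.2 k)
            (pathFun (n + 1) r.1.2 r.1.1 r.2 (k + 1))) ?_)
      exact hm.comp (f := fun r : (X × X) × (Fin n → X) => (r.1.2, r.1.1, r.2))
        (by fun_prop)
    simp_rw [key]
    rw [lintegral_lintegral_swap hm'.aemeasurable, ← hp1 0 a]
    refine lintegral_congr fun x => ?_
    have hmx : Measurable fun b => ∫⁻ η : Fin n → X, ∏ k ∈ Finset.range (n + 1),
        p (k + 1) (pathFun (n + 1) x b η k) (pathFun (n + 1) x b η (k + 1)) := by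
      refine Measurable.lintegral_prod_right'
        (f := fun r : X × (Fin n → X) => ∏ k ∈ Finset.range (n + 1),
          p (k + 1) (pathFun (n + 1) x r.1 r.2 k) (pathFun (n + 1) x r.1 r.2 (k + 1))) ?_
      exact hm.comp (measurable_const.prodMk measurable_id)
    rw [lintegral_const_mul _ hmx, ih (fun k => p (k + 1)) (fun k => hp _) (fun k => hp1 _) x,
      mul_one]

theorem lintegral_ofReal_eq_one {X : Type*} [MeasurableSpace X] {μ : Measure X} {f : X → ℝ}
    (hf : ∀ x, 0 ≤ f x) (h : ∫ x, f x ∂μ = 1) : ∫⁻ x, ENNReal.ofReal (f x) ∂μ = 1 := by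
  rw [← ofReal_integral_eq_lintegral_ofReal
    (Integrable.of_integral_ne_zero (by rw [h]; exact one_ne_zero)) (ae_of_all _ hf), h,
    ENNReal.ofReal_one]

theorem ofReal_integral_le_lintegral_ofReal {X : Type*} [MeasurableSpace X] {μ : Measure X}
    {f : X → ℝ} (hf : ∀ x, 0 ≤ f x) :
    ENNReal.ofReal (∫ x, f x ∂μ) ≤ ∫⁻ x, ENNReal.ofReal (f x) ∂μ := by
  by_cases h : Integrable f μ
  · exact (ofReal_integral_eq_lintegral_ofReal h (ae_of_all _ hf)).le
  · simp [integral_undef h]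

section PathDensity

variable {Z X : Type*}

/-- Density of proposing the endpoint `w` along the path with interior points `η`, started at
`x`, where the `k`-th step uses the transition density `P (c k w.1)`. -/
def pathDensity (n : ℕ) (e : ℝ) (q : Z → ℝ) (P : Z → X → X → ℝ) (c : ℕ → Z → Z) (x : X)
    (w : Z × X) (η : Fin n → X) : ℝ :=
  e * q w.1 * ∏ k ∈ Finset.range (n + 1),
    P (c k w.1) (pathFun (n + 1) x w.2 η k) (pathFun (n + 1) x w.2 η (k + 1))

theorem pathDensity_nonneg {n : ℕ} {e : ℝ} {q : Z → ℝ} {P : Z → X → X → ℝ} (c : ℕ → Z → Z)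
    (x : X) (he : 0 ≤ e) (hq : ∀ z, 0 ≤ q z) (hP : ∀ z x y, 0 ≤ P z x y) (w : Z × X)
    (η : Fin n → X) : 0 ≤ pathDensity n e q P c x w η :=
  mul_nonneg (mul_nonneg he (hq _)) (Finset.prod_nonneg fun _ _ => hP _ _ _)

variable [MeasureSpace Z] [MeasureSpace X]

theorem measurable_pathDensity {n : ℕ} (e : ℝ) {q : Z → ℝ} {P : Z → X → X → ℝ} {c : ℕ → Z → Z}
    (x : X) (hq : Measurable q)
    (hP : Measurable fun r : Z × X × X => P r.1 r.2.1 r.2.2) (hc : ∀ k, Measurable (c k)) :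
    Measurable fun r : (Z × X) × (Fin n → X) => pathDensity n e q P c x r.1 r.2 := by
  refine Measurable.mul (by fun_prop) (Finset.measurable_prod _ fun k _ => ?_)
  have h : ∀ k, Measurable fun r : (Z × X) × (Fin n → X) => pathFun (n + 1) x r.1.2 r.2 k :=
    fun k => (measurable_pathFun n k).comp (f := fun r : (Z × X) × (Fin n → X) =>
      (x, r.1.2, r.2)) (by fun_prop)
  exact hP.comp (f := fun r : (Z × X) × (Fin n → X) => (c k r.1.1,
    pathFun (n + 1) x r.1.2 r.2 k, pathFun (n + 1) x r.1.2 r.2 (k + 1)))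
    (((hc k).comp (by fun_prop)).prodMk ((h k).prodMk (h (k + 1))))

variable [SigmaFinite (volume : Measure X)]

theorem lintegral_pathDensity_le {n : ℕ} {e : ℝ} {q : Z → ℝ} {P : Z → X → X → ℝ}
    {c : ℕ → Z → Z} (x : X) (he : 0 ≤ e) (hq : Measurable q) (hq0 : ∀ z, 0 ≤ q z)
    (hq1 : ∫ z, q z = 1)
    (hP : Measurable fun r : Z × X × X => P r.1 r.2.1 r.2.2) (hP0 : ∀ z x y, 0 ≤ P z x y)
    (hP1 : ∀ z x, ∫ y, P z x y = 1) (hc : ∀ k, Measurable (c k)) :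
    ∫⁻ w, ∫⁻ η : Fin n → X, ENNReal.ofReal (pathDensity n e q P c x w η) ≤ ENNReal.ofReal e := by
  have hm := (measurable_pathDensity (n := n) e x hq hP hc).ennreal_ofReal
  rw [Measure.volume_eq_prod, lintegral_prod _ hm.lintegral_prod_right.aemeasurable]
  have key : ∀ z, ∫⁻ b, ∫⁻ η : Fin n → X, ENNReal.ofReal (pathDensity n e q P c x (z, b) η) =
      ENNReal.ofReal e * ENNReal.ofReal (q z) := by
    intro z
    have hsplit : ∀ b (η : Fin n → X), ENNReal.ofReal (pathDensity n e q P c x (z, b) η) =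
        (ENNReal.ofReal e * ENNReal.ofReal (q z)) * ∏ k ∈ Finset.range (n + 1),
          ENNReal.ofReal (P (c k z) (pathFun (n + 1) x b η k) (pathFun (n + 1) x b η (k + 1))) := by
      intro b η
      rw [pathDensity, ENNReal.ofReal_mul (mul_nonneg he (hq0 _)), ENNReal.ofReal_mul he,
        ENNReal.ofReal_prod_of_nonneg fun _ _ => hP0 _ _ _]
    have hne : ENNReal.ofReal e * ENNReal.ofReal (q z) ≠ ⊤ :=
      ENNReal.mul_ne_top ENNReal.ofReal_ne_top ENNReal.ofReal_ne_top
    simp_rw [hsplit, lintegral_const_mul' _ _ hne]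
    rw [lintegral_prod_pathFun n (fun k x y => ENNReal.ofReal (P (c k z) x y)) ?_ ?_ x, mul_one]
    · intro k
      exact (hP.comp (measurable_const.prodMk measurable_id)).ennreal_ofReal
    · exact fun k y => lintegral_ofReal_eq_one (hP0 _ _) (hP1 _ _)
  simp_rw [key]
  rw [lintegral_const_mul' _ _ ENNReal.ofReal_ne_top, lintegral_ofReal_eq_one hq0 hq1, mul_one]

theorem integral_le_of_le_pathDensity {n : ℕ} {e : ℝ} {q : Z → ℝ} {P : Z → X → X → ℝ}
    {c c' : ℕ → Z → Z} (x : X) (he : 0 ≤ e) (hq : Measurable q) (hq0 : ∀ z, 0 ≤ q z)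
    (hq1 : ∫ z, q z = 1)
    (hP : Measurable fun r : Z × X × X => P r.1 r.2.1 r.2.2) (hP0 : ∀ z x y, 0 ≤ P z x y)
    (hP1 : ∀ z x, ∫ y, P z x y = 1) (hc : ∀ k, Measurable (c k)) (hc' : ∀ k, Measurable (c' k))
    (f : Z × X → (Fin n → X) → ℝ) (hf0 : ∀ w η, 0 ≤ f w η)
    (hf : ∀ w η, f w η ≤ pathDensity n e q P c x w η + pathDensity n e q P c' x w η) :
    ∫ w, (1 / 2) * ∫ η, f w η ≤ e := by
  have hm := (measurable_pathDensity (n := n) e x hq hP hc).ennreal_ofReal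
  have hle : ∫⁻ w, ∫⁻ η, ENNReal.ofReal (f w η) ≤ ENNReal.ofReal e + ENNReal.ofReal e := calc
    _ ≤ ∫⁻ w, ∫⁻ η, (ENNReal.ofReal (pathDensity n e q P c x w η) +
          ENNReal.ofReal (pathDensity n e q P c' x w η)) := by
        gcongr with w η
        exact (ENNReal.ofReal_le_ofReal (hf w η)).trans ENNReal.ofReal_add_le
    _ = (∫⁻ w, ∫⁻ η, ENNReal.ofReal (pathDensity n e q P c x w η)) +
          ∫⁻ w, ∫⁻ η, ENNReal.ofReal (pathDensity n e q P c' x w η) := by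
        rw [← lintegral_add_left hm.lintegral_prod_right]
        refine lintegral_congr fun w => lintegral_add_left ?_ _
        exact hm.comp (measurable_const.prodMk measurable_id)
    _ ≤ _ := add_le_add (lintegral_pathDensity_le x he hq hq0 hq1 hP hP0 hP1 hc)
        (lintegral_pathDensity_le x he hq hq0 hq1 hP hP0 hP1 hc')
  have h2 : ENNReal.ofReal (∫ w, ∫ η, f w η) ≤ ENNReal.ofReal (e + e) := by
    rw [ENNReal.ofReal_add he he]
    exact (ofReal_integral_le_lintegral_ofReal fun w => integral_nonneg (hf0 w)).trans
      ((lintegral_mono fun w => ofReal_integral_le_lintegral_ofReal (hf0 w)).trans hle)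
  rw [integral_const_mul]
  have := (ENNReal.ofReal_le_ofReal_iff (by positivity)).1 h2
  linarith

end PathDensity

theorem prod_Icc_one_eq_prod_range {M : Type*} [CommMonoid M] (K : ℕ) (f : ℕ → M) :
    ∏ k ∈ Finset.Icc 1 K, f k = ∏ k ∈ Finset.range K, f (k + 1) := by
  rw [Finset.range_eq_Ico, Finset.prod_Ico_add' f 0 K 1]
  rfl

theorem map_swap_withDensity_of_symm {E : Type*} [MeasurableSpace E] {μ : Measure E} [SFinite μ]
    {f : E × E → ENNReal} (hf : ∀ q, f q.swap = f q) :
    Measure.map Prod.swap ((μ.prod μ).withDensity f) = (μ.prod μ).withDensity f := by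
  ext s hs
  rw [Measure.map_apply measurable_swap hs, withDensity_apply _ (measurable_swap hs),
    withDensity_apply _ hs]
  calc ∫⁻ q in Prod.swap ⁻¹' s, f q ∂μ.prod μ
      = ∫⁻ q in Prod.swap ⁻¹' s, f q.swap ∂μ.prod μ := by simp_rw [hf]
    _ = ∫⁻ q in s, f q ∂μ.prod μ :=
      Measure.measurePreserving_swap.setLIntegral_comp_preimage_emb
        MeasurableEquiv.prodComm.measurableEmbedding f s

theorem map_swap_map_diag {E : Type*} [MeasurableSpace E] (μ : Measure E) :
    Measure.map Prod.swap (Measure.map (fun u => (u, u)) μ) = Measure.map (fun u => (u, u)) μ := by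
  rw [Measure.map_map measurable_swap (by fun_prop)]
  rfl

/-- Reversibility of the stochastically symmetric ('coin') path algorithm: with
`𝒬_c` the accepted-move joint density, one has `∫ 𝒬_c(u, ·) ≤ exp(−βV(u))`, and
the joint law `π` of `(X_n, X_{n+1})` (off-diagonal density `𝒵⁻¹ 𝒬_c` plus the
diagonal rejection part) is invariant under the swap `(u, v) ↦ (v, u)`,
i.e. the chain is reversible with respect to `ν = 𝒵⁻¹ exp(−βV) du`. -/
theorem stmt6 (ℓ d : ℕ) (hℓ : 0 < ℓ) (hld : ℓ < d)
    (β : ℝ) (hβ : 0 < β)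
    (V : (Fin ℓ → ℝ) → (Fin (d - ℓ) → ℝ) → ℝ)
    (hV : Measurable (Function.uncurry V))
    (Zc : ℝ)
    (hZc : Zc = ∫ x : (Fin ℓ → ℝ) × (Fin (d - ℓ) → ℝ), Real.exp (-β * V x.1 x.2))
    (hZpos : 0 < Zc)
    (hZfin : Integrable (fun x : (Fin ℓ → ℝ) × (Fin (d - ℓ) → ℝ) =>
      Real.exp (-β * V x.1 x.2)))
    (Q : (Fin ℓ → ℝ) → (Fin ℓ → ℝ) → ℝ)
    (hQmeas : Measurable (Function.uncurry Q))
    (hQnonneg : ∀ z z', 0 ≤ Q z z')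
    (hQnorm : ∀ z, ∫ z', Q z z' = 1)
    (P : (Fin ℓ → ℝ) → (Fin (d - ℓ) → ℝ) → (Fin (d - ℓ) → ℝ) → ℝ)
    (hPmeas : Measurable (fun q : (Fin ℓ → ℝ) × (Fin (d - ℓ) → ℝ) × (Fin (d - ℓ) → ℝ) =>
      P q.1 q.2.1 q.2.2))
    (hPnonneg : ∀ z x y, 0 ≤ P z x y)
    (hPnorm : ∀ z x, (∫ y, P z x y) = 1)
    (K : ℕ) (hK : 1 ≤ K)
    (zbar : ℕ → (Fin ℓ → ℝ) → (Fin ℓ → ℝ) → (Fin ℓ → ℝ))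
    (hzbarmeas : ∀ k, Measurable (Function.uncurry (zbar k)))
    (hzbar0 : ∀ a b, zbar 0 a b = a)
    (hzbarK : ∀ a b, zbar K a b = b)
    (Qc : ((Fin ℓ → ℝ) × (Fin (d - ℓ) → ℝ)) →
      ((Fin ℓ → ℝ) × (Fin (d - ℓ) → ℝ)) → ℝ)
    (hQc : ∀ u v, Qc u v = (1 / 2) *
      ∫ η : Fin (K - 1) → (Fin (d - ℓ) → ℝ),
        (min
          (Real.exp (-β * V u.1 u.2) * Q u.1 v.1 *
            ∏ k ∈ Finset.Icc 1 K,
              P (zbar k u.1 v.1) (pathFun K u.2 v.2 η (k - 1)) (pathFun K u.2 v.2 η k))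
          (Real.exp (-β * V v.1 v.2) * Q v.1 u.1 *
            ∏ k ∈ Finset.range K,
              P (zbar k v.1 u.1) (pathFun K u.2 v.2 η (K - k))
                (pathFun K u.2 v.2 η (K - k - 1))) +
        min
          (Real.exp (-β * V u.1 u.2) * Q u.1 v.1 *
            ∏ k ∈ Finset.Icc 1 K,
              P (zbar (k - 1) u.1 v.1) (pathFun K u.2 v.2 η (k - 1)) (pathFun K u.2 v.2 η k))
          (Real.exp (-β * V v.1 v.2) * Q v.1 u.1 *
            ∏ k ∈ Finset.range K,
              P (zbar (k + 1) v.1 u.1) (pathFun K u.2 v.2 η (K - k))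
                (pathFun K u.2 v.2 η (K - k - 1))))) :
    (∀ u, (∫ w, Qc u w) ≤ Real.exp (-β * V u.1 u.2)) ∧
    (Measure.map Prod.swap
        ((volume.prod volume).withDensity
            (fun q => ENNReal.ofReal (Zc⁻¹ * Qc q.1 q.2)) +
          Measure.map (fun u => (u, u))
            (volume.withDensity fun u =>
              ENNReal.ofReal (Zc⁻¹ * Real.exp (-β * V u.1 u.2)) -
                ENNReal.ofReal (Zc⁻¹ * ∫ w, Qc u w))) =
      (volume.prod volume).withDensity
          (fun q => ENNReal.ofReal (Zc⁻¹ * Qc q.1 q.2)) +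
        Measure.map (fun u => (u, u))
          (volume.withDensity fun u =>
            ENNReal.ofReal (Zc⁻¹ * Real.exp (-β * V u.1 u.2)) -
              ENNReal.ofReal (Zc⁻¹ * ∫ w, Qc u w))) := by
  constructor
  · intro u
    simp_rw [hQc u]
    obtain ⟨n, rfl⟩ : ∃ n, K = n + 1 := ⟨K - 1, by omega⟩
    refine integral_le_of_le_pathDensity (n := n) (q := Q u.1) (P := P)
      (c := fun k z => zbar (k + 1) u.1 z) (c' := fun k z => zbar k u.1 z) u.2 (Real.exp_pos _).le
      hQmeas.of_uncurry_left (hQnonneg _) (hQnorm _) hPmeas hPnonneg hPnorm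
      (fun k => (hzbarmeas _).of_uncurry_left) (fun k => (hzbarmeas _).of_uncurry_left) _ ?_ ?_
    · intro w η
      have hw : ∀ (z₁ z₂ : Fin ℓ → ℝ) (t : ℝ) (s : Finset ℕ) (c : ℕ → Fin ℓ → ℝ)
          (x y : ℕ → Fin (d - ℓ) → ℝ),
          0 ≤ Real.exp t * Q z₁ z₂ * ∏ k ∈ s, P (c k) (x k) (y k) := fun _ _ _ _ _ _ _ =>
        mul_nonneg (mul_nonneg (Real.exp_pos _).le (hQnonneg _ _))
          (Finset.prod_nonneg fun _ _ => hPnonneg _ _ _)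
      exact add_nonneg (le_min (hw _ _ _ _ _ _ _) (hw _ _ _ _ _ _ _))
        (le_min (hw _ _ _ _ _ _ _) (hw _ _ _ _ _ _ _))
    · intro w η
      refine add_le_add ((min_le_left _ _).trans_eq ?_) ((min_le_left _ _).trans_eq ?_) <;>
      · rw [pathDensity, prod_Icc_one_eq_prod_range]
        rfl
  · have hsymm : ∀ u v, Qc v u = Qc u v := by
      intro u v
      rw [hQc, hQc]
      congr 1
      rw [← (volume_measurePreserving_piCongrLeft (fun _ : Fin (K - 1) => Fin (d - ℓ) → ℝ)
        Fin.revPerm).integral_comp (MeasurableEquiv.measurableEmbedding _)]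
      refine integral_congr_ae (ae_of_all _ fun η => ?_)
      have hη : MeasurableEquiv.piCongrLeft (fun _ : Fin (K - 1) => Fin (d - ℓ) → ℝ)
          Fin.revPerm η = fun i => η i.rev := by
        ext1 i
        have h := Equiv.piCongrLeft_apply_apply (fun _ : Fin (K - 1) => Fin (d - ℓ) → ℝ)
          Fin.revPerm η i.rev
        rwa [Fin.revPerm_apply, Fin.rev_rev] at h
      have hfwd : ∀ c : ℕ → Fin ℓ → ℝ, ∏ k ∈ Finset.range K,
          P (c k) (pathFun K v.2 u.2 (fun i => η i.rev) k)
            (pathFun K v.2 u.2 (fun i => η i.rev) (k + 1)) = ∏ k ∈ Finset.range K,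
          P (c k) (pathFun K u.2 v.2 η (K - k)) (pathFun K u.2 v.2 η (K - k - 1)) := by
        intro c
        refine Finset.prod_congr rfl fun k hk => ?_
        rw [Finset.mem_range] at hk
        rw [pathFun_rev K hK _ _ _ k (by omega), pathFun_rev K hK _ _ _ (k + 1) (by omega),
          Nat.sub_sub]
      have hbwd : ∀ c : ℕ → Fin ℓ → ℝ, ∏ k ∈ Finset.range K,
          P (c k) (pathFun K v.2 u.2 (fun i => η i.rev) (K - k))
            (pathFun K v.2 u.2 (fun i => η i.rev) (K - k - 1)) = ∏ k ∈ Finset.range K,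
          P (c k) (pathFun K u.2 v.2 η k) (pathFun K u.2 v.2 η (k + 1)) := by
        intro c
        refine Finset.prod_congr rfl fun k hk => ?_
        rw [Finset.mem_range] at hk
        rw [pathFun_rev K hK _ _ _ (K - k) (by omega), pathFun_rev K hK _ _ _ (K - k - 1) (by omega)]
        congr 2 <;> omega
      simp only [hη, prod_Icc_one_eq_prod_range, Nat.add_sub_cancel]
      rw [hfwd (fun k => zbar (k + 1) v.1 u.1), hfwd (fun k => zbar k v.1 u.1),
        hbwd (fun k => zbar (k + 1) u.1 v.1), hbwd (fun k => zbar k u.1 v.1),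
        add_comm, min_comm, min_comm (_ * _ * ∏ k ∈ Finset.range K, P (zbar (k + 1) v.1 u.1) _ _)]
    rw [Measure.map_add _ _ measurable_swap, map_swap_map_diag,
      map_swap_withDensity_of_symm fun q => ?_]
    simp only [Prod.fst_swap, Prod.snd_swap, hsymm q.1 q.2]
end

section
/- Fix points ζ₀, …, ζ_K ∈ ℝ^ℓ with K ≥ 1. Assume 0 < ∫ exp(−βV(ζ₀, x)) dx < ∞ and 0 < ∫ exp(−βV(ζ_K, x)) dx < ∞, and that for each k ∈ {0, …, K−1} the kernel P_{ζ_k} leaves the conditional measure ν_⊥(· | ζ_k) invariant, i.e. ∫ exp(−βV(ζ_k, x)) P_{ζ_k}(x, y) dx = exp(−βV(ζ_k, y)) for almost every y ∈ ℝ^{d−ℓ}. Then for every bounded measurable φ : ℝ^{d−ℓ} → ℝ, ∫_{(ℝ^{d−ℓ})^{K+1}} φ(ξ_K) exp( −β ∑_{k=0}^{K−1} [ V(ζ_{k+1}, ξ_{k+1}) − V(ζ_k, ξ_{k+1}) ] ) · [ exp(−βV(ζ₀, ξ₀)) / ∫ exp(−βV(ζ₀, x)) dx ] · ∏_{k=1}^{K}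 P_{ζ_{k−1}}(ξ_{k−1}, ξ_k) dξ₀ ⋯ dξ_K = exp( −β (F(ζ_K) − F(ζ₀)) ) ∫_{ℝ^{d−ℓ}} φ(y) ν_⊥(dy | ζ_K). That is, the discrete Jarzynski–Crooks work 𝒲⁰ = ∑_{k=0}^{K−1} [ V(ζ_{k+1}, ξ_{k+1}) − V(ζ_k, ξ_{k+1}) ], computed along the path where ξ₀ ∼ ν_⊥(· | ζ₀) and ξ_{k+1} ∼ P_{ζ_k}(ξ_k, ·), satisfies the Jarzynski equality E[ φ(ξ_K) exp(−β𝒲⁰) ] = exp(−β(F(ζ_K) − F(ζ₀))) ∫ φ dν_⊥(· | ζ_K). -/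
open MeasureTheory

/-- Extension of a tuple `η : Fin n → X` to a function on `ℕ` (the value beyond
`n` is irrelevant). -/
def extendPath {X : Type*} [Inhabited X] {n : ℕ} (η : Fin n → X) : ℕ → X :=
  fun k => if h : k < n then η ⟨k, h⟩ else default

theorem measurable_extendPath {X : Type*} [Inhabited X] [MeasurableSpace X] {n : ℕ} (k : ℕ) :
    Measurable (fun η : Fin n → X => extendPath η k) := by
  unfold extendPath
  split_ifs <;> fun_prop

open scoped ENNReal in
/-- If each transition density `Q k` transports the density `w k` to `w (k + 1)`, then the
endpoint of the path of length `n` started from `w 0` has density `w n`. -/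
theorem lintegral_extendPath_transport {X : Type*} [Inhabited X] [MeasurableSpace X]
    (μ : Measure X) [SigmaFinite μ] {w : ℕ → X → ℝ≥0∞} {Q : ℕ → X → X → ℝ≥0∞}
    (hw : Measurable (w 0)) (hQ : ∀ k, Measurable (Function.uncurry (Q k))) (n : ℕ)
    (h : ∀ k < n, ∀ᵐ y ∂μ, ∫⁻ x, w k x * Q k x y ∂μ = w (k + 1) y)
    {g : X → ℝ≥0∞} (hg : Measurable g) :
    ∫⁻ ξ : Fin (n + 1) → X, g (extendPath ξ n) * (w 0 (extendPath ξ 0) *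
      ∏ k ∈ Finset.range n, Q k (extendPath ξ k) (extendPath ξ (k + 1)))
        ∂Measure.pi (fun _ => μ) = ∫⁻ y, g y * w n y ∂μ := by
  induction n generalizing g with
  | zero =>
    rw [← (measurePreserving_funUnique μ (Fin 1)).lintegral_comp_emb
      (MeasurableEquiv.measurableEmbedding _)]
    simp only [Finset.range_zero, Finset.prod_empty, mul_one]
    congr!
  | succ n ih =>
    have hcast (y : X) (η : Fin (n + 1) → X) (k : ℕ) (hk : k ≤ n) :
        extendPath ((Fin.last (n + 1)).insertNth y η : Fin (n + 2) → X) k = extendPath η k := by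
      have h1 : k < n + 1 := by omega
      have h2 : k < n + 1 + 1 := by omega
      simp only [extendPath, h1, h2, dif_pos]
      have : (⟨k, h2⟩ : Fin (n + 2)) = Fin.castSucc ⟨k, h1⟩ := rfl
      rw [this, Fin.insertNth_last', Fin.snoc_castSucc]
    have hlast (y : X) (η : Fin (n + 1) → X) :
        extendPath ((Fin.last (n + 1)).insertNth y η : Fin (n + 2) → X) (n + 1) = y := by
      have h2 : n + 1 < n + 1 + 1 := by omega
      simp only [extendPath, h2, dif_pos]
      have : (⟨n + 1, h2⟩ : Fin (n + 2)) = Fin.last (n + 1) := rfl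
      rw [this, Fin.insertNth_last', Fin.snoc_last]
    have hext := measurable_extendPath (X := X) (n := n + 1)
    have hprod : Measurable (fun η : Fin (n + 1) → X =>
        ∏ k ∈ Finset.range n, Q k (extendPath η k) (extendPath η (k + 1))) :=
      Finset.measurable_fun_prod _ fun k _ => (hQ k).comp ((hext k).prodMk (hext (k + 1)))
    rw [← (measurePreserving_piFinSuccAbove (fun _ : Fin (n + 2) => μ)
      (Fin.last (n + 1))).symm.lintegral_comp_emb (MeasurableEquiv.measurableEmbedding _)]
    have hsplit (z : X × (Fin (n + 1) → X)) :
        (MeasurableEquiv.piFinSuccAbove (fun _ : Fin (n + 2) => X) (Fin.last (n + 1))).symm z =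
          (Fin.last (n + 1)).insertNth z.1 z.2 := rfl
    have hstep (z : X × (Fin (n + 1) → X)) :
        ∏ k ∈ Finset.range n,
          Q k (extendPath ((Fin.last (n + 1)).insertNth z.1 z.2 : Fin (n + 2) → X) k)
            (extendPath ((Fin.last (n + 1)).insertNth z.1 z.2 : Fin (n + 2) → X) (k + 1)) =
        ∏ k ∈ Finset.range n, Q k (extendPath z.2 k) (extendPath z.2 (k + 1)) := by
      refine Finset.prod_congr rfl fun k hk => ?_
      have := Finset.mem_range.1 hk
      rw [hcast _ _ _ (by omega), hcast _ _ _ (by omega)]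
    simp only [hsplit, Finset.prod_range_succ, hstep, hlast, hcast _ _ _ le_rfl,
      hcast _ _ _ (Nat.zero_le n)]
    have hQn : Measurable (fun z : X × (Fin (n + 1) → X) => Q n (extendPath z.2 n) z.1) :=
      (hQ n).comp (((hext n).comp measurable_snd).prodMk measurable_fst)
    rw [lintegral_prod]
    swap
    · exact ((hg.comp measurable_fst).mul
      (((hw.comp (hext 0)).comp measurable_snd).mul
        ((hprod.comp measurable_snd).mul hQn))).aemeasurable
    refine lintegral_congr_ae ?_
    filter_upwards [h n (Nat.lt_succ_self n)] with y hy
    have hQy : Measurable (fun x => Q n x y) := (hQ n).comp (measurable_id.prodMk measurable_const)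
    rw [lintegral_const_mul]
    · rw [← hy]
      congr 1
      simp only [mul_comm (w n _)]
      rw [← ih (fun k hk => h k (by omega)) hQy]
      exact lintegral_congr fun η => by ring
    · exact (hw.comp (hext 0)).mul (hprod.mul (hQy.comp (hext n)))

/-- Real-valued form of `lintegral_extendPath_transport`. -/
theorem integral_extendPath_transport {X : Type*} [Inhabited X] [MeasurableSpace X]
    (μ : Measure X) [SigmaFinite μ] {w : ℕ → X → ℝ} {Q : ℕ → X → X → ℝ}
    (hw : ∀ k, Measurable (w k)) (hQ : ∀ k, Measurable (Function.uncurry (Q k)))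
    (hw0 : ∀ k x, 0 < w k x) (hQ0 : ∀ k x y, 0 ≤ Q k x y) (n : ℕ)
    (h : ∀ k < n, ∀ᵐ y ∂μ, ∫ x, w k x * Q k x y ∂μ = w (k + 1) y)
    {g : X → ℝ} (hg : Measurable g) :
    ∫ ξ : Fin (n + 1) → X, (w 0 (extendPath ξ 0) *
      ∏ k ∈ Finset.range n, Q k (extendPath ξ k) (extendPath ξ (k + 1))) * g (extendPath ξ n)
        ∂Measure.pi (fun _ => μ) = ∫ y, w n y * g y ∂μ := by
  have hext := measurable_extendPath (X := X) (n := n + 1)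
  set D : (Fin (n + 1) → X) → ℝ := fun ξ => w 0 (extendPath ξ 0) *
    ∏ k ∈ Finset.range n, Q k (extendPath ξ k) (extendPath ξ (k + 1)) with hD
  have hDm : Measurable D := ((hw 0).comp (hext 0)).mul (Finset.measurable_fun_prod _ fun k _ =>
    (hQ k).comp ((hext k).prodMk (hext (k + 1))))
  have hD0 (ξ) : 0 ≤ D ξ := mul_nonneg (hw0 _ _).le (Finset.prod_nonneg fun _ _ => hQ0 _ _ _)
  have hlaw : ((Measure.pi fun _ => μ).withDensity fun ξ => ENNReal.ofReal (D ξ)).map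
      (fun ξ => extendPath ξ n) = μ.withDensity fun y => ENNReal.ofReal (w n y) := by
    refine Measure.ext_of_lintegral _ fun f hf => ?_
    rw [lintegral_map hf (hext n), lintegral_withDensity_eq_lintegral_mul _ hDm.ennreal_ofReal
      (g := fun ξ => f (extendPath ξ n)) (hf.comp (hext n)), lintegral_withDensity_eq_lintegral_mul _ (hw n).ennreal_ofReal hf]
    simp only [Pi.mul_apply, mul_comm _ (f _)]
    rw [← lintegral_extendPath_transport μ (w := fun k x => ENNReal.ofReal (w k x))
      (Q := fun k x y => ENNReal.ofReal (Q k x y)) (hw 0).ennreal_ofReal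
      (fun k => (hQ k).ennreal_ofReal) n (fun k hk => ?_) hf]
    · refine lintegral_congr fun ξ => ?_
      rw [hD, ENNReal.ofReal_mul (hw0 _ _).le,
        ENNReal.ofReal_prod_of_nonneg fun _ _ => hQ0 _ _ _]
    · filter_upwards [h k hk] with y hy
      have hint : Integrable (fun x => w k x * Q k x y) μ :=
        Integrable.of_integral_ne_zero (by rw [hy]; exact (hw0 _ _).ne')
      simp only [← ENNReal.ofReal_mul (hw0 k _).le]
      rw [← ofReal_integral_eq_lintegral_ofReal hint
        (.of_forall fun x => mul_nonneg (hw0 _ _).le (hQ0 _ _ _)), hy]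
  have hint := integral_map (hext n).aemeasurable
    (μ := (Measure.pi fun _ => μ).withDensity fun ξ => ENNReal.ofReal (D ξ))
    hg.aestronglyMeasurable
  rw [hlaw, integral_withDensity_eq_integral_toReal_smul (hw n).ennreal_ofReal (by simp),
    integral_withDensity_eq_integral_toReal_smul hDm.ennreal_ofReal (by simp)] at hint
  simpa [ENNReal.toReal_ofReal, hD0, (hw0 _ _).le] using hint.symm

/-- Discrete Jarzynski equality for the work
`𝒲⁰ = ∑_{k=0}^{K−1} [V(ζ_{k+1}, ξ_{k+1}) − V(ζ_k, ξ_{k+1})]` along the path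
where `ξ_0 ∼ ν_⊥(·|ζ_0)` and `ξ_{k+1} ∼ P_{ζ_k}(ξ_k, ·)`:
`E[φ(ξ_K) exp(−β𝒲⁰)] = exp(−β(F(ζ_K) − F(ζ_0))) ∫ φ dν_⊥(·|ζ_K)`,
provided each kernel `P_{ζ_k}`, `0 ≤ k ≤ K − 1`, leaves `ν_⊥(·|ζ_k)` invariant. -/
theorem stmt13 (ℓ d : ℕ) (hℓ : 0 < ℓ) (hld : ℓ < d)
    (β : ℝ) (hβ : 0 < β)
    (V : (Fin ℓ → ℝ) → (Fin (d - ℓ) → ℝ) → ℝ)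
    (hV : Measurable (Function.uncurry V))
    (Zc : ℝ)
    (hZc : Zc = ∫ x : (Fin ℓ → ℝ) × (Fin (d - ℓ) → ℝ), Real.exp (-β * V x.1 x.2))
    (hZpos : 0 < Zc)
    (hZfin : Integrable (fun x : (Fin ℓ → ℝ) × (Fin (d - ℓ) → ℝ) =>
      Real.exp (-β * V x.1 x.2)))
    (F : (Fin ℓ → ℝ) → ℝ)
    (hF : ∀ z, F z = -β⁻¹ * Real.log (Zc⁻¹ * ∫ x : Fin (d - ℓ) → ℝ,
      Real.exp (-β * V z x)))
    (P : (Fin ℓ → ℝ) → (Fin (d - ℓ) → ℝ) → (Fin (d - ℓ) → ℝ) → ℝ)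
    (hPmeas : Measurable (fun q : (Fin ℓ → ℝ) × (Fin (d - ℓ) → ℝ) × (Fin (d - ℓ) → ℝ) =>
      P q.1 q.2.1 q.2.2))
    (hPnonneg : ∀ z x y, 0 ≤ P z x y)
    (hPnorm : ∀ z x, (∫ y, P z x y) = 1)
    (K : ℕ) (hK : 1 ≤ K)
    (ζ : ℕ → (Fin ℓ → ℝ))
    (h0pos : 0 < ∫ x : Fin (d - ℓ) → ℝ, Real.exp (-β * V (ζ 0) x))
    (h0fin : Integrable (fun x : Fin (d - ℓ) → ℝ => Real.exp (-β * V (ζ 0) x)))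
    (hKpos : 0 < ∫ x : Fin (d - ℓ) → ℝ, Real.exp (-β * V (ζ K) x))
    (hKfin : Integrable (fun x : Fin (d - ℓ) → ℝ => Real.exp (-β * V (ζ K) x)))
    (hinv : ∀ k, k < K →
      ∀ᵐ y : Fin (d - ℓ) → ℝ,
        (∫ x, Real.exp (-β * V (ζ k) x) * P (ζ k) x y) = Real.exp (-β * V (ζ k) y))
    (φ : (Fin (d - ℓ) → ℝ) → ℝ)
    (hφmeas : Measurable φ) (hφbdd : ∃ C, ∀ x, |φ x| ≤ C) :
    ∫ ξ : Fin (K + 1) → (Fin (d - ℓ) → ℝ),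
        φ (extendPath ξ K) *
          Real.exp (-β * ∑ k ∈ Finset.range K,
            (V (ζ (k + 1)) (extendPath ξ (k + 1)) - V (ζ k) (extendPath ξ (k + 1)))) *
          (Real.exp (-β * V (ζ 0) (extendPath ξ 0)) /
            ∫ x : Fin (d - ℓ) → ℝ, Real.exp (-β * V (ζ 0) x)) *
          ∏ k ∈ Finset.Icc 1 K, P (ζ (k - 1)) (extendPath ξ (k - 1)) (extendPath ξ k) =
      Real.exp (-β * (F (ζ K) - F (ζ 0))) *
        ∫ y : Fin (d - ℓ) → ℝ,
          φ y * (Zc⁻¹ * Real.exp (-β * V (ζ K) y) / Real.exp (-β * F (ζ K))) := by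
  have hVm (k : ℕ) : Measurable (V (ζ k)) := hV.comp (measurable_const.prodMk measurable_id)
  have hPm (k : ℕ) : Measurable (Function.uncurry (P (ζ k))) :=
    hPmeas.comp (measurable_const.prodMk measurable_id)
  have key := integral_extendPath_transport (volume : Measure (Fin (d - ℓ) → ℝ))
    (w := fun k x => Real.exp (-β * V (ζ k) x))
    (Q := fun k x y => P (ζ k) x y * Real.exp (-β * (V (ζ (k + 1)) y - V (ζ k) y)))
    (fun k => ((hVm k).const_mul _).exp)
    (fun k => (hPm k).mul ((((hVm (k + 1)).sub (hVm k)).const_mul _).exp.comp measurable_snd))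
    (fun _ _ => Real.exp_pos _) (fun _ _ _ => mul_nonneg (hPnonneg _ _ _) (Real.exp_pos _).le)
    K (fun k hk => by
      filter_upwards [hinv k hk] with y hy
      simp only [← mul_assoc]
      rw [integral_mul_const, hy, ← Real.exp_add]
      congr 1
      ring) hφmeas
  have hexpF (z) (hz : 0 < ∫ x, Real.exp (-β * V z x)) :
      Real.exp (-β * F z) = Zc⁻¹ * ∫ x, Real.exp (-β * V z x) := by
    rw [hF, ← mul_assoc, neg_mul_neg, mul_inv_cancel₀ hβ.ne', one_mul,
      Real.exp_log (mul_pos (inv_pos.2 hZpos) hz)]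
  have hF₀ := hexpF _ h0pos
  have hF₁ := hexpF _ hKpos
  set I₀ := ∫ x, Real.exp (-β * V (ζ 0) x)
  set I₁ := ∫ x, Real.exp (-β * V (ζ K) x)
  have hright : Real.exp (-β * (F (ζ K) - F (ζ 0))) *
      ∫ y, φ y * (Zc⁻¹ * Real.exp (-β * V (ζ K) y) / Real.exp (-β * F (ζ K))) =
      I₀⁻¹ * ∫ y, Real.exp (-β * V (ζ K) y) * φ y := by
    rw [← integral_const_mul, ← integral_const_mul, mul_sub, Real.exp_sub, hF₁, hF₀]
    refine integral_congr_ae (.of_forall fun y => ?_)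
    dsimp only
    field_simp
  rw [hright, ← key, ← integral_const_mul]
  refine integral_congr_ae (.of_forall fun ξ => ?_)
  have hprod : ∏ k ∈ Finset.Icc 1 K, P (ζ (k - 1)) (extendPath ξ (k - 1)) (extendPath ξ k) =
      ∏ k ∈ Finset.range K, P (ζ k) (extendPath ξ k) (extendPath ξ (k + 1)) := by
    rw [Finset.range_eq_Ico]
    exact (Finset.prod_Ico_add' (fun k => P (ζ (k - 1)) (extendPath ξ (k - 1))
      (extendPath ξ k)) 0 K 1).symm
  dsimp only
  rw [hprod, Finset.prod_mul_distrib, Finset.mul_sum, Real.exp_sum]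
  ring
end
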